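/- Let G be a finite simple undirected graph, let k ≥ 1, let t₁,…,t_k be distinct vertices of G, and let →G, G' be as in the subdivision construction applied with the constant weight function w ≡ 1. Define q': V(G') → [0,∞] by q'(v) = ∞ for every v ∈ V(G) and q'(a(v,u)) = 1 for every subdivision vertex, and define p': V(G') × {1,…,k} → [0,∞] by p'(t_j, i) = ∞ whenever i ≠ j, and p'(x, i) = 1 otherwise. Then for every natural number r: there exists a partition (V₁,…,V_k) of V(G) with t_i ∈ V_i for every i such that the number of edges of G whose endpoints lie in different parts is at most r, if and only if there exists an assignment f: V(G') → {1,…,k} with Σ_{x∈V(G')} p'(x, f(x)) + Δ(f,q',G') ≤ r + |V(G')|. -/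

import Mathlib

open scoped Classical
open Finset

noncomputable section

/-- Transfer cost `Δ(f, q, G)` of an assignment `f` of the vertices of a digraph with
arc relation `A` to `k` machines. -/
def transferCost {V : Type*} [Fintype V] (A : V → V → Prop) (k : ℕ)
    (f : V → Fin k) (q : V → ENNReal) : ENNReal :=
  ∑ i : Fin k, ∑ v ∈ Finset.univ.filter (fun v => f v = i),
    ∑ j ∈ Finset.univ.filter (fun j => j ≠ i),
      if ∃ u, A v u ∧ f u = j then q v else 0

/-- Vertices of the subdivided DAG `G'`: original vertices together with one
subdivision vertex `a(v,u)` for every arc `(v,u)` of `→G` (the orientation of `G`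
from smaller to larger endpoint). -/
abbrev SubVertex {V : Type*} (G : SimpleGraph V) [LinearOrder V] :=
  V ⊕ {p : V × V // G.Adj p.1 p.2 ∧ p.1 < p.2}

/-- Arcs of `G'`: `(v, a(v,u))` and `(a(v,u), u)` for every arc `(v,u)` of `→G`. -/
def subArc {V : Type*} (G : SimpleGraph V) [LinearOrder V] :
    SubVertex G → SubVertex G → Prop
  | Sum.inl v, Sum.inr a => a.1.1 = v
  | Sum.inr a, Sum.inl u => a.1.2 = u
  | _, _ => False

/-- The function `q` on `V(G')`: `∞` on original vertices, `w({v,u})` on `a(v,u)`. -/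
def subQ {V : Type*} (G : SimpleGraph V) [LinearOrder V] (w : Sym2 V → NNReal) :
    SubVertex G → ENNReal
  | Sum.inl _ => ⊤
  | Sum.inr a => (w s(a.1.1, a.1.2) : ENNReal)

/-- The function `p` on `V(G') × [k]`: `p(t_j, i) = ∞` whenever `i ≠ j`, and `0` otherwise. -/
def subP {V : Type*} (G : SimpleGraph V) [LinearOrder V] {k : ℕ} (t : Fin k → V) :
    SubVertex G → Fin k → ENNReal :=
  fun x i => match x with
    | Sum.inl v => if ∃ j : Fin k, t j = v ∧ j ≠ i then ⊤ else 0
    | Sum.inr _ => 0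

/-- The function `p'` with value `1` instead of `0`: `p'(t_j, i) = ∞` whenever `i ≠ j`,
and `p'(x, i) = 1` otherwise. -/
def subP' {V : Type*} (G : SimpleGraph V) [LinearOrder V] {k : ℕ} (t : Fin k → V) :
    SubVertex G → Fin k → ENNReal :=
  fun x i => match x with
    | Sum.inl v => if ∃ j : Fin k, t j = v ∧ j ≠ i then ⊤ else 1
    | Sum.inr _ => 1

theorem transferCost_eq_sum {V : Type*} [Fintype V] (A : V → V → Prop) (k : ℕ)
    (f : V → Fin k) (q : V → ENNReal) :
    transferCost A k f q =
      ∑ v, ∑ j, if j ≠ f v ∧ ∃ u, A v u ∧ f u = j then q v else 0 := by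
  unfold transferCost
  rw [← Finset.sum_fiberwise (s := Finset.univ) (g := f)]
  refine Finset.sum_congr rfl fun i _ => Finset.sum_congr rfl fun v hv => ?_
  obtain rfl : f v = i := by simpa using hv
  rw [Finset.sum_filter]
  refine Finset.sum_congr rfl fun j _ => ?_
  by_cases h : j = f v <;> simp [h]

theorem eq_of_transferCost_ne_top {V : Type*} [Fintype V] {A : V → V → Prop} {k : ℕ}
    {f : V → Fin k} {q : V → ENNReal} (h : transferCost A k f q ≠ ⊤) {v u : V}
    (hq : q v = ⊤) (ha : A v u) : f u = f v := by
  by_contra hne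
  apply h
  rw [transferCost_eq_sum, ENNReal.sum_eq_top]
  refine ⟨v, Finset.mem_univ _, ENNReal.sum_eq_top.2 ⟨f u, Finset.mem_univ _, ?_⟩⟩
  rw [if_pos ⟨hne, u, ha, rfl⟩, hq]

theorem transferCost_subArc_eq {V : Type*} [Fintype V] [LinearOrder V] (G : SimpleGraph V)
    {k : ℕ} (f : SubVertex G → Fin k)
    (hf : ∀ a : {p : V × V // G.Adj p.1 p.2 ∧ p.1 < p.2},
      f (Sum.inr a) = f (Sum.inl a.1.1)) :
    transferCost (subArc G) k f (subQ G (fun _ => 1)) =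
      ((∑ v : V, ∑ u : V,
        if G.Adj v u ∧ v < u ∧ f (Sum.inl v) ≠ f (Sum.inl u) then 1 else 0 : ℕ) : ENNReal) := by
  have hl : ∀ v : V, (∑ j, if j ≠ f (Sum.inl v) ∧ ∃ u, subArc G (Sum.inl v) u ∧ f u = j
      then subQ G (fun _ => 1) (Sum.inl v) else 0) = 0 := by
    intro v
    refine Finset.sum_eq_zero fun j _ => if_neg ?_
    rintro ⟨hj, u | a, hu, rfl⟩
    · exact hu
    · obtain rfl : a.1.1 = v := hu
      exact hj (hf a)
  have hr : ∀ a : {p : V × V // G.Adj p.1 p.2 ∧ p.1 < p.2},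
      (∑ j, if j ≠ f (Sum.inr a) ∧ ∃ u, subArc G (Sum.inr a) u ∧ f u = j
        then subQ G (fun _ => 1) (Sum.inr a) else 0) =
      if f (Sum.inl a.1.1) ≠ f (Sum.inl a.1.2) then (1 : ENNReal) else 0 := by
    intro a
    rw [Finset.sum_eq_single (f (Sum.inl a.1.2))]
    · have : ∃ u, subArc G (Sum.inr a) u ∧ f u = f (Sum.inl a.1.2) :=
        ⟨Sum.inl a.1.2, rfl, rfl⟩
      simp [this, hf, subQ, eq_comm]
    · rintro j - hj
      refine if_neg ?_
      rintro ⟨-, u | b, hu, rfl⟩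
      · obtain rfl : a.1.2 = u := hu
        exact hj rfl
      · exact hu
    · simp
  rw [transferCost_eq_sum, Fintype.sum_sum_type, Finset.sum_congr rfl fun v _ => hl v,
    Finset.sum_congr rfl fun a _ => hr a, Finset.sum_const_zero, zero_add]
  push_cast
  rw [← Fintype.sum_prod_type' (f := fun v u : V =>
    if G.Adj v u ∧ v < u ∧ f (Sum.inl v) ≠ f (Sum.inl u) then (1 : ENNReal) else 0)]
  rw [← Finset.sum_subtype (Finset.univ.filter fun p : V × V => G.Adj p.1 p.2 ∧ p.1 < p.2)
    (by simp) (fun p : V × V => if f (Sum.inl p.1) ≠ f (Sum.inl p.2) then (1 : ENNReal) else 0),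
    Finset.sum_filter]
  refine Finset.sum_congr rfl fun p _ => ?_
  simp only [← ite_and, and_assoc]

theorem sum_subP'_eq_card {V : Type*} [Fintype V] [LinearOrder V] (G : SimpleGraph V)
    {k : ℕ} (t : Fin k → V) (f : SubVertex G → Fin k) (hf : ∀ i, f (Sum.inl (t i)) = i) :
    ∑ x, subP' G t x (f x) = (Fintype.card (SubVertex G) : ENNReal) := by
  have h : ∀ x, subP' G t x (f x) = 1 := by
    rintro (v | a)
    · refine if_neg ?_
      rintro ⟨j, rfl, hj⟩
      exact hj (hf j).symm
    · rfl
  simp only [h, Finset.sum_const, Finset.card_univ, nsmul_eq_mul, mul_one]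

theorem eq_of_sum_subP'_ne_top {V : Type*} [Fintype V] [LinearOrder V] {G : SimpleGraph V}
    {k : ℕ} {t : Fin k → V} {f : SubVertex G → Fin k}
    (h : ∑ x, subP' G t x (f x) ≠ ⊤) (i : Fin k) : f (Sum.inl (t i)) = i := by
  by_contra hne
  exact h (ENNReal.sum_eq_top.2 ⟨Sum.inl (t i), Finset.mem_univ _, if_pos ⟨i, rfl, Ne.symm hne⟩⟩)

theorem stmt3 {V : Type*} [Fintype V] [LinearOrder V] (G : SimpleGraph V)
    (k : ℕ) (hk : 1 ≤ k) (t : Fin k → V) (ht : Function.Injective t) (r : ℕ) :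
    (∃ g : V → Fin k, (∀ i, g (t i) = i) ∧
      (∑ v : V, ∑ u : V,
        if G.Adj v u ∧ v < u ∧ g v ≠ g u then 1 else 0) ≤ r)
    ↔
    (∃ f : SubVertex G → Fin k,
      (∑ x : SubVertex G, subP' G t x (f x))
        + transferCost (subArc G) k f (subQ G (fun _ => 1))
        ≤ (r : ENNReal) + (Fintype.card (SubVertex G) : ENNReal)) := by
  constructor
  · rintro ⟨g, hg, hr⟩
    refine ⟨Sum.elim g fun a => g a.1.1, ?_⟩
    rw [sum_subP'_eq_card G t _ hg, transferCost_subArc_eq G _ fun _ => rfl, add_comm]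
    gcongr
    exact_mod_cast hr
  · rintro ⟨f, hf⟩
    obtain ⟨hp, hc⟩ := ENNReal.add_ne_top.1 (ne_top_of_le_ne_top
      (ENNReal.add_ne_top.2 ⟨ENNReal.natCast_ne_top _, ENNReal.natCast_ne_top _⟩) hf)
    have ht := eq_of_sum_subP'_ne_top hp
    refine ⟨fun v => f (Sum.inl v), ht, ?_⟩
    rw [sum_subP'_eq_card G t f ht, transferCost_subArc_eq G f fun a =>
      eq_of_transferCost_ne_top hc rfl rfl, add_comm] at hf
    exact_mod_cast (ENNReal.add_le_add_iff_right (ENNReal.natCast_ne_top _)).1 hf
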